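/- Let N be a natural number, p ≥ 2 a real number, and p' = p/(p−1) its Hölder conjugate. Then for all a, b ∈ ℝᴺ: ( ‖(a+b)/2‖^p + ‖(a−b)/2‖^p )^{1/p} ≤ ( (1/2)‖a‖^{p'} + (1/2)‖b‖^{p'} )^{1/p'}, where ‖·‖ is the Euclidean norm on ℝᴺ. (Local Clarkson inequality for vectors.) -/

import Mathlib

/-- The interpolating function in Friedrichs' proof of Clarkson's inequality. -/
noncomputable def friedrichsFun (r s c : ℝ) : ℝ :=
  (1 + c ^ (-r) * s) * (1 + c * s) ^ r + (1 - c ^ (-r) * s) * (1 - c * s) ^ r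

lemma hasDerivAt_friedrichsFun {r s c : ℝ} (hs : 0 ≤ s) (hs1 : s ≤ 1) (hc : 0 < c) (hc1 : c < 1) :
    HasDerivAt (friedrichsFun r s)
      (r * s * (1 - c ^ (-r - 1)) * ((1 + c * s) ^ (r - 1) - (1 - c * s) ^ (r - 1))) c := by
  have hcs : 0 < 1 - c * s := by nlinarith
  have hcs' : 0 < 1 + c * s := by positivity
  have hpow : HasDerivAt (fun x : ℝ => x ^ (-r) * s) (-r * c ^ (-r - 1) * s) c :=
    (Real.hasDerivAt_rpow_const (Or.inl hc.ne')).mul_const s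
  have hlin : HasDerivAt (fun x : ℝ => x * s) s c := by
    simpa using (hasDerivAt_id c).mul_const s
  have hplus := (hlin.const_add 1).rpow_const (p := r) (Or.inl hcs'.ne')
  have hminus := (hlin.const_sub 1).rpow_const (p := r) (Or.inl hcs.ne')
  have h := ((hpow.const_add 1).mul hplus).add ((hpow.const_sub 1).mul hminus)
  refine h.congr_deriv ?_
  have e1 : (1 + c * s) ^ r = (1 + c * s) ^ (r - 1) * (1 + c * s) := by
    rw [← Real.rpow_add_one hcs'.ne']; ring_nf
  have e2 : (1 - c * s) ^ r = (1 - c * s) ^ (r - 1) * (1 - c * s) := by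
    rw [← Real.rpow_add_one hcs.ne']; ring_nf
  have e3 : c ^ (-r) = c ^ (-r - 1) * c := by
    rw [← Real.rpow_add_one hc.ne']; ring_nf
  rw [e1, e2, e3]
  ring

lemma friedrichsFun_le_one {r s c : ℝ} (hr : 0 < r) (hr1 : r ≤ 1) (hs : 0 ≤ s) (hs1 : s ≤ 1)
    (hc : 0 < c) (hc1 : c ≤ 1) : friedrichsFun r s c ≤ friedrichsFun r s 1 := by
  have hmono : MonotoneOn (friedrichsFun r s) (Set.Icc c 1) := by
    refine monotoneOn_of_hasDerivWithinAt_nonneg (convex_Icc c 1) (f' := fun c =>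
      r * s * (1 - c ^ (-r - 1)) * ((1 + c * s) ^ (r - 1) - (1 - c * s) ^ (r - 1))) ?_ ?_ ?_
    · have hpow : ContinuousOn (fun x : ℝ => x ^ (-r)) (Set.Icc c 1) := fun x hx =>
        (Real.continuousAt_rpow_const x _
          (Or.inl (hc.trans_le hx.1).ne')).continuousWithinAt
      have hplus : Continuous fun x : ℝ => (1 + x * s) ^ r :=
        (by fun_prop : Continuous fun x : ℝ => 1 + x * s).rpow_const fun _ => Or.inr hr.le
      have hminus : Continuous fun x : ℝ => (1 - x * s) ^ r :=
        (by fun_prop : Continuous fun x : ℝ => 1 - x * s).rpow_const fun _ => Or.inr hr.le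
      exact ((continuousOn_const.add (hpow.mul continuousOn_const)).mul hplus.continuousOn).add
        ((continuousOn_const.sub (hpow.mul continuousOn_const)).mul hminus.continuousOn)
    · intro x hx
      rw [interior_Icc] at hx
      exact (hasDerivAt_friedrichsFun hs hs1 (hc.trans hx.1) hx.2).hasDerivWithinAt
    · intro x hx
      rw [interior_Icc] at hx
      have hx0 : 0 < x := hc.trans hx.1
      have h1 : 1 ≤ x ^ (-r - 1) :=
        Real.one_le_rpow_of_pos_of_le_one_of_nonpos hx0 hx.2.le (by linarith)
      have h2 : (1 + x * s) ^ (r - 1) ≤ (1 - x * s) ^ (r - 1) :=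
        Real.rpow_le_rpow_of_nonpos (by nlinarith [hx.2]) (by nlinarith) (by linarith)
      have h3 : 0 ≤ r * s := by positivity
      exact mul_nonneg_of_nonpos_of_nonpos
        (mul_nonpos_of_nonneg_of_nonpos h3 (by linarith)) (by linarith)
  exact hmono (Set.left_mem_Icc.2 hc1) (Set.right_mem_Icc.2 hc1) hc1

lemma one_add_rpow_le_of_holderConjugate {p q s : ℝ} (hpq : p.HolderConjugate q) (hp : 2 ≤ p)
    (hs : 0 ≤ s) (hs1 : s ≤ 1) :
    (1 + s ^ p) ^ (q - 1) ≤ ((1 + s) ^ q + (1 - s) ^ q) / 2 := by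
  rcases hs.eq_or_lt with rfl | hs0
  · simp [Real.zero_rpow hpq.ne_zero]
  have hr : 0 < q - 1 := hpq.symm.sub_one_pos
  have hmul : (p - 1) * (q - 1) = 1 := by have := hpq.mul_eq_add; linarith
  have hr1 : q - 1 ≤ 1 := by nlinarith
  have h := friedrichsFun_le_one hr hr1 hs hs1 (Real.rpow_pos_of_pos hs0 (p - 1))
    (Real.rpow_le_one hs hs1 (by linarith))
  have e1 : (s ^ (p - 1)) ^ (-(q - 1)) * s = 1 := by
    rw [← Real.rpow_mul hs, mul_neg, hmul, Real.rpow_neg_one, inv_mul_cancel₀ hs0.ne']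
  have e2 : s ^ (p - 1) * s = s ^ p := by
    rw [← Real.rpow_add_one hs0.ne']; ring_nf
  have e3 : (1 + s) * (1 + s) ^ (q - 1) = (1 + s) ^ q := by
    rw [mul_comm, ← Real.rpow_add_one' (by linarith) (by linarith)]; ring_nf
  have e4 : (1 - s) * (1 - s) ^ (q - 1) = (1 - s) ^ q := by
    rw [mul_comm, ← Real.rpow_add_one' (by linarith) (by linarith)]; ring_nf
  simp only [friedrichsFun, e1, e2, Real.one_rpow, one_mul, e3, e4] at h
  linarith

lemma rpow_add_rpow_le_of_holderConjugate {p q u v : ℝ} (hpq : p.HolderConjugate q) (hp : 2 ≤ p)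
    (hv : 0 ≤ v) (hvu : v ≤ u) :
    u ^ p + v ^ p ≤ (((u + v) ^ q + (u - v) ^ q) / 2) ^ (p - 1) := by
  rcases (hv.trans hvu).eq_or_lt with rfl | hu
  · obtain rfl : v = 0 := le_antisymm hvu hv
    simp only [Real.zero_rpow hpq.ne_zero, add_zero, sub_zero]
    positivity
  obtain ⟨s, rfl⟩ : ∃ s, v = u * s := ⟨v / u, by field_simp⟩
  have hs : 0 ≤ s := nonneg_of_mul_nonneg_right hv hu
  have hs1 : s ≤ 1 := by nlinarith
  have hmul : (q - 1) * (p - 1) = 1 := by have := hpq.mul_eq_add; linarith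
  have hqp : q * (p - 1) = p := by have := hpq.mul_eq_add; linarith
  have h := Real.rpow_le_rpow (by positivity)
    (one_add_rpow_le_of_holderConjugate hpq hp hs hs1) hpq.sub_one_pos.le
  rw [← Real.rpow_mul (by positivity), hmul, Real.rpow_one] at h
  have h1s : 0 ≤ 1 - s := by linarith
  calc u ^ p + (u * s) ^ p = u ^ p * (1 + s ^ p) := by rw [Real.mul_rpow hu.le hs]; ring
    _ ≤ u ^ p * (((1 + s) ^ q + (1 - s) ^ q) / 2) ^ (p - 1) := by gcongr
    _ = (u ^ q * (((1 + s) ^ q + (1 - s) ^ q) / 2)) ^ (p - 1) := by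
      rw [Real.mul_rpow (by positivity) (by positivity), ← Real.rpow_mul hu.le, hqp]
    _ = _ := by
      rw [show u + u * s = u * (1 + s) by ring, show u - u * s = u * (1 - s) by ring,
        Real.mul_rpow hu.le (by linarith), Real.mul_rpow hu.le h1s]
      ring_nf

lemma ConvexOn.add_le_add_of_add_eq {f : ℝ → ℝ} {S : Set ℝ} (hf : ConvexOn ℝ S f) {x y u v : ℝ}
    (hu : u ∈ S) (hv : v ∈ S) (hx : x ≤ u) (hy : y ≤ u) (h : x + y = u + v) :
    f x + f y ≤ f u + f v := by
  rcases (show v ≤ u by linarith).eq_or_lt with rfl | hvu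
  · obtain rfl : x = v := by linarith
    obtain rfl : y = x := by linarith
    exact le_rfl
  have hd : 0 < u - v := by linarith
  have hα : 0 ≤ (x - v) / (u - v) := div_nonneg (by linarith) hd.le
  have hβ : 0 ≤ (y - v) / (u - v) := div_nonneg (by linarith) hd.le
  have hαβ : (x - v) / (u - v) + (y - v) / (u - v) = 1 := by
    rw [← add_div, div_eq_one_iff_eq hd.ne']; linarith
  have h1 := hf.2 hu hv hα hβ hαβ
  have h2 := hf.2 hu hv hβ hα (by linarith)
  have ex : (x - v) / (u - v) * (u - v) = x - v := div_mul_cancel₀ _ hd.ne'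
  have ey : (y - v) / (u - v) * (u - v) = y - v := div_mul_cancel₀ _ hd.ne'
  generalize (x - v) / (u - v) = α at *
  generalize (y - v) / (u - v) = β at *
  obtain rfl : β = 1 - α := by linarith
  simp only [smul_eq_mul] at h1 h2
  rw [show α * u + (1 - α) * v = x by linarith] at h1
  rw [show (1 - α) * u + α * v = y by linarith] at h2
  linarith

/-- Clarkson's inequality in a real inner product space, for vectors ordered by norm. -/
lemma norm_rpow_add_norm_rpow_le_of_norm_le {E : Type*} [NormedAddCommGroup E]
    [InnerProductSpace ℝ E] {p q : ℝ} (hpq : p.HolderConjugate q) (hp : 2 ≤ p) {a b : E}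
    (hab : ‖b‖ ≤ ‖a‖) :
    ‖(1 / 2 : ℝ) • (a + b)‖ ^ p + ‖(1 / 2 : ℝ) • (a - b)‖ ^ p ≤
      (1 / 2 * ‖a‖ ^ q + 1 / 2 * ‖b‖ ^ q) ^ (p - 1) := by
  have hsq : ∀ {x : ℝ}, 0 ≤ x → (x ^ 2) ^ (p / 2) = x ^ p := fun {x} hx => by
    rw [← Real.rpow_natCast, ← Real.rpow_mul hx]; congr 1; push_cast; ring
  have hU : ‖(1 / 2 : ℝ) • (a + b)‖ = ‖a + b‖ / 2 := by
    rw [norm_smul]; norm_num; ring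
  have hV : ‖(1 / 2 : ℝ) • (a - b)‖ = ‖a - b‖ / 2 := by
    rw [norm_smul]; norm_num; ring
  have hpar := parallelogram_law_with_norm ℝ a b
  have hUle := norm_add_le a b
  have hVle := norm_sub_le a b
  have hconv := (convexOn_rpow (p := p / 2) (by linarith)).add_le_add_of_add_eq
    (x := (‖a + b‖ / 2) ^ 2) (y := (‖a - b‖ / 2) ^ 2)
    (u := ((‖a‖ + ‖b‖) / 2) ^ 2) (v := ((‖a‖ - ‖b‖) / 2) ^ 2)
    (Set.mem_Ici.2 (by positivity)) (Set.mem_Ici.2 (by positivity))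
    (by gcongr) (by gcongr) (by linarith)
  rw [hsq (by positivity), hsq (by positivity), hsq (by positivity), hsq (by linarith)] at hconv
  rw [hU, hV]
  refine hconv.trans ((rpow_add_rpow_le_of_holderConjugate hpq hp (by linarith)
    (by linarith [norm_nonneg b])).trans_eq ?_)
  ring_nf

theorem stmt11 (N : ℕ) (p p' : ℝ) (hp : 2 ≤ p) (hp' : p' = p / (p - 1))
    (a b : EuclideanSpace ℝ (Fin N)) :
    (‖(1 / 2 : ℝ) • (a + b)‖ ^ p + ‖(1 / 2 : ℝ) • (a - b)‖ ^ p) ^ (1 / p) ≤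
      (1 / 2 * ‖a‖ ^ p' + 1 / 2 * ‖b‖ ^ p') ^ (1 / p') := by
  have hpq : p.HolderConjugate p' := (Real.holderConjugate_iff_eq_conjExponent (by linarith)).2 hp'
  have key : ‖(1 / 2 : ℝ) • (a + b)‖ ^ p + ‖(1 / 2 : ℝ) • (a - b)‖ ^ p ≤
      (1 / 2 * ‖a‖ ^ p' + 1 / 2 * ‖b‖ ^ p') ^ (p - 1) := by
    rcases le_total ‖b‖ ‖a‖ with h | h
    · exact norm_rpow_add_norm_rpow_le_of_norm_le hpq hp h
    · have := norm_rpow_add_norm_rpow_le_of_norm_le hpq hp h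
      rwa [add_comm b a, norm_smul _ (b - a), norm_sub_rev b a, ← norm_smul,
        add_comm (1 / 2 * ‖b‖ ^ p')] at this
  have hexp : (p - 1) * (1 / p) = 1 / p' := by
    rw [hp', one_div_div, mul_one_div]
  calc _ ≤ ((1 / 2 * ‖a‖ ^ p' + 1 / 2 * ‖b‖ ^ p') ^ (p - 1)) ^ (1 / p) :=
        Real.rpow_le_rpow (by positivity) key (by positivity)
    _ = _ := by rw [← Real.rpow_mul (by positivity), hexp]
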